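/- Suppose the hyperplanes in 𝒜 are pairwise non-parallel. Then for every k with 1 ≤ k ≤ n, w_k(B_k) ≤ ∑_{A ∈ 𝒜_k} w_k(A) ≤ ∑_{A ∈ 𝒜_k} ν(F(A)) = ∑_{A ∈ 𝒜_k} ∏_{j ∈ F(A)} 1/((1−δ_j)|S_j|). -/

import Mathlib

open Finset
open scoped Classical

/-- A hyperplane in `S_1 × ⋯ × S_n`.  Coordinates are 0-indexed in Lean:
coordinate `j : ℕ`, `j < n`, corresponds to the paper's coordinate `j + 1`,
so the paper's set `S_j` is `S (j - 1)` here.  A hyperplane is recorded by its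
finite set `F` of fixed coordinates together with the fixed value at each
fixed coordinate (on the non-fixed coordinates it is all of `S j`). -/
structure Hyp (S : ℕ → Type) (n : ℕ) where
  F : Finset ℕ
  hF : ∀ j ∈ F, j < n
  val : ∀ j ∈ F, S j

/-- The stage of a hyperplane: in the paper's 1-based labelling,
`A.stage = max F(A)`; in the 0-based labelling it is `(sup of A.F) + 1`. -/
def Hyp.stage {S : ℕ → Type} {n : ℕ} (A : Hyp S n) : ℕ := A.F.sup id + 1

/-- `Qp S k` is the paper's `Q_k = S_1 × ⋯ × S_k` (in 0-based indexing,
`S 0 × ⋯ × S (k-1)`).  `Qp S 0` is a one-element type. -/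
abbrev Qp (S : ℕ → Type) (k : ℕ) := ∀ j : Fin k, S j

/-- `x ∈ Q_k` lies on (the projection to `Q_k` of) the hyperplane `A`;
this is the correct notion of membership whenever `F(A) ⊆ {1, …, k}`. -/
def memH {S : ℕ → Type} {n : ℕ} (A : Hyp S n) {k : ℕ} (x : Qp S k) : Prop :=
  ∀ (j : Fin k) (h : (j : ℕ) ∈ A.F), x j = A.val j h

/-- Membership in `B_k = ⋃_{A ∈ 𝒜_k} A`, viewed as a subset of `Q_k`, where
`𝒜_k = {A ∈ 𝒜 : max F(A) = k}` (1-based `k`). -/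
def memB {S : ℕ → Type} {n : ℕ} {ι : Type} (𝓐 : ι → Hyp S n) (k : ℕ) (x : Qp S k) : Prop :=
  ∃ i, (𝓐 i).stage = k ∧ memH (𝓐 i) x

/-- `alpha 𝓐 k x` is the paper's `α_{k+1}(x)` for `x ∈ Q_k`: the proportion of
the fiber `F_x` covered by `B_{k+1}`. -/
noncomputable def alpha {S : ℕ → Type} [∀ j, Fintype (S j)] {n : ℕ} {ι : Type}
    (𝓐 : ι → Hyp S n) (k : ℕ) (x : Qp S k) : ℝ :=
  ((univ.filter fun y : S k => memB 𝓐 (k + 1) (Fin.snoc x y)).card : ℝ) /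
    (Fintype.card (S k))

/-- The weights `w_k : Q_k → ℝ`, defined inductively:  `w_0 ≡ 1`, and `w_(k+1)`
is obtained from `w_k` by the distortion rule with parameter `δ_{k+1} = δ k`.
(The paper's `δ_j` is `δ (j - 1)` here.) -/
noncomputable def w {S : ℕ → Type} [∀ j, Fintype (S j)] {n : ℕ} {ι : Type}
    (𝓐 : ι → Hyp S n) (δ : ℕ → ℝ) : (k : ℕ) → Qp S k → ℝ
  | 0, _ => 1
  | (k + 1), x =>
      let x' : Qp S k := fun j => x j.castSucc
      let a : ℝ := alpha 𝓐 k x'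
      if memB 𝓐 (k + 1) x then
        if a ≤ δ k then 0
        else ((a - δ k) / (a * (1 - δ k))) * (w 𝓐 δ k x' / (Fintype.card (S k)))
      else
        if a ≤ δ k then (1 / (1 - a)) * (w 𝓐 δ k x' / (Fintype.card (S k)))
        else (1 / (1 - δ k)) * (w 𝓐 δ k x' / (Fintype.card (S k)))

/-- `w_k(B_k)` (1-based `k`). -/
noncomputable def wB {S : ℕ → Type} [∀ j, Fintype (S j)] {n : ℕ} {ι : Type}
    (𝓐 : ι → Hyp S n) (δ : ℕ → ℝ) (k : ℕ) : ℝ :=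
  ∑ x ∈ univ.filter (memB 𝓐 k), w 𝓐 δ k x

/-- `w_k(A)`: the weight of the projection to `Q_k` of a hyperplane `A`
(meaningful when `F(A) ⊆ {1, …, k}`). -/
noncomputable def wH {S : ℕ → Type} [∀ j, Fintype (S j)] {n : ℕ} {ι : Type}
    (𝓐 : ι → Hyp S n) (δ : ℕ → ℝ) (k : ℕ) (A : Hyp S n) : ℝ :=
  ∑ x ∈ univ.filter (fun x : Qp S k => memH A x), w 𝓐 δ k x

/-- `ν(J) = ∏_{j ∈ J} 1 / ((1 - δ_j)|S_j|)` (0-based `J`). -/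
noncomputable def nu (S : ℕ → Type) [∀ j, Fintype (S j)] (δ : ℕ → ℝ) (J : Finset ℕ) : ℝ :=
  ∏ j ∈ J, 1 / ((1 - δ j) * (Fintype.card (S j)))

/-- `‖J‖ = ∏_{j ∈ J} |S_j|` (0-based `J`). -/
noncomputable def normJ (S : ℕ → Type) [∀ j, Fintype (S j)] (J : Finset ℕ) : ℝ :=
  ∏ j ∈ J, (Fintype.card (S j) : ℝ)

/-- `Ew 𝓐 δ k` is the paper's `E_k = E_{(k+1)-1} = ∑_{x ∈ Q_k} α_{k+1}(x)² w_k(x)`. -/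
noncomputable def Ew {S : ℕ → Type} [∀ j, Fintype (S j)] {n : ℕ} {ι : Type}
    (𝓐 : ι → Hyp S n) (δ : ℕ → ℝ) (k : ℕ) : ℝ :=
  ∑ x : Qp S k, (alpha 𝓐 k x) ^ 2 * w 𝓐 δ k x

/-- Membership in a hyperplane, split at the last coordinate. -/
theorem memH_snoc {S : ℕ → Type} {n : ℕ} (A : Hyp S n) {k : ℕ} (x : Qp S k) (y : S k) :
    memH A (k := k + 1) (Fin.snoc (α := fun j : Fin (k + 1) => S j) x y) ↔
      memH A x ∧ ∀ h : k ∈ A.F, y = A.val k h := by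
  constructor
  · intro H
    refine ⟨fun j h => ?_, fun h => ?_⟩
    · simpa using H j.castSucc h
    · simpa using H (Fin.last k) h
  · rintro ⟨H, H'⟩ j
    refine Fin.lastCases ?_ (fun i => ?_) j
    · intro h
      simpa using H' h
    · intro h
      simpa using H i h

theorem sum_Qp_succ {S : ℕ → Type} [∀ j, Fintype (S j)] {k : ℕ} (f : Qp S (k + 1) → ℝ) :
    ∑ x, f x =
      ∑ x : Qp S k, ∑ y : S k, f (Fin.snoc (α := fun j : Fin (k + 1) => S j) x y) := by
  rw [← (Fin.snocEquiv fun j : Fin (k + 1) => S j).sum_comp, Fintype.sum_prod_type_right]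
  rfl

/-- The distortion rule on the fiber over `x`. -/
theorem w_snoc {S : ℕ → Type} [∀ j, Fintype (S j)] {n : ℕ} {ι : Type}
    (𝓐 : ι → Hyp S n) (δ : ℕ → ℝ) {k : ℕ} (x : Qp S k) (y : S k) :
    w 𝓐 δ (k + 1) (Fin.snoc (α := fun j : Fin (k + 1) => S j) x y) =
      if memB 𝓐 (k + 1) (Fin.snoc (α := fun j : Fin (k + 1) => S j) x y) then
        if alpha 𝓐 k x ≤ δ k then 0
        else ((alpha 𝓐 k x - δ k) / (alpha 𝓐 k x * (1 - δ k))) *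
          (w 𝓐 δ k x / (Fintype.card (S k)))
      else
        if alpha 𝓐 k x ≤ δ k then
          (1 / (1 - alpha 𝓐 k x)) * (w 𝓐 δ k x / (Fintype.card (S k)))
        else (1 / (1 - δ k)) * (w 𝓐 δ k x / (Fintype.card (S k))) := by
  have hx : (fun j : Fin k =>
      Fin.snoc (α := fun j : Fin (k + 1) => S j) x y j.castSucc) = x := by
    funext j
    exact Fin.snoc_castSucc (α := fun j : Fin (k + 1) => S j) y x j
  rw [w]
  simp only [hx]

theorem alpha_nonneg {S : ℕ → Type} [∀ j, Fintype (S j)] {n : ℕ} {ι : Type}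
    (𝓐 : ι → Hyp S n) (k : ℕ) (x : Qp S k) : 0 ≤ alpha 𝓐 k x := by
  unfold alpha
  positivity

theorem alpha_le_one {S : ℕ → Type} [∀ j, Fintype (S j)] {n : ℕ} {ι : Type}
    (𝓐 : ι → Hyp S n) (k : ℕ) (x : Qp S k) : alpha 𝓐 k x ≤ 1 := by
  unfold alpha
  refine div_le_one_of_le₀ ?_ (by positivity)
  exact_mod_cast Finset.card_le_univ _

theorem w_nonneg {S : ℕ → Type} [∀ j, Fintype (S j)] {n : ℕ} {ι : Type}
    (𝓐 : ι → Hyp S n) (δ : ℕ → ℝ) (k : ℕ) (hδ : ∀ j < k, δ j ∈ Set.Ico (0 : ℝ) 1)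
    (x : Qp S k) : 0 ≤ w 𝓐 δ k x := by
  induction k with
  | zero => simp [w]
  | succ k ih =>
    rw [w]
    have h := ih (fun j hj => hδ j (by omega)) (fun j => x j.castSucc)
    have h1 := sub_pos.2 (hδ k (by omega)).2
    have h2 := alpha_nonneg 𝓐 k (fun j => x j.castSucc)
    have h3 := sub_nonneg.2 (alpha_le_one 𝓐 k (fun j => x j.castSucc))
    split_ifs with _ ha ha
    · exact le_rfl
    · have h4 := sub_nonneg.2 (not_le.1 ha).le
      positivity
    all_goals positivity

theorem w_snoc_le {S : ℕ → Type} [∀ j, Fintype (S j)] {n : ℕ} {ι : Type}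
    (𝓐 : ι → Hyp S n) (δ : ℕ → ℝ) {k : ℕ} (hδ : δ k ∈ Set.Ico (0 : ℝ) 1) (x : Qp S k)
    (hw : 0 ≤ w 𝓐 δ k x) (y : S k) :
    w 𝓐 δ (k + 1) (Fin.snoc (α := fun j : Fin (k + 1) => S j) x y) ≤
      (1 / ((1 - δ k) * Fintype.card (S k))) * w 𝓐 δ k x := by
  have h1 := sub_pos.2 hδ.2
  have hq : 0 ≤ w 𝓐 δ k x / (Fintype.card (S k)) := by positivity
  have e : (1 / ((1 - δ k) * Fintype.card (S k))) * w 𝓐 δ k x =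
      (1 / (1 - δ k)) * (w 𝓐 δ k x / (Fintype.card (S k))) := by
    rw [one_div_mul_eq_div, one_div_mul_eq_div, div_div, mul_comm]
  rw [w_snoc, e]
  split_ifs with _ ha ha
  · positivity
  · have h2 : 0 < alpha 𝓐 k x := hδ.1.trans_lt (not_le.1 ha)
    refine mul_le_mul_of_nonneg_right ?_ hq
    rw [div_le_div_iff₀ (by positivity) h1]
    nlinarith [mul_nonneg hδ.1 h1.le]
  · exact mul_le_mul_of_nonneg_right
      (one_div_le_one_div_of_le h1 (by linarith)) hq
  · exact le_rfl

/-- The distortion rule preserves the total weight of each fiber. -/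
theorem sum_w_snoc {S : ℕ → Type} [∀ j, Fintype (S j)] {n : ℕ} {ι : Type}
    (𝓐 : ι → Hyp S n) (δ : ℕ → ℝ) {k : ℕ} (hδ : δ k ∈ Set.Ico (0 : ℝ) 1)
    (hS : 0 < Fintype.card (S k)) (x : Qp S k) :
    ∑ y : S k, w 𝓐 δ (k + 1) (Fin.snoc (α := fun j : Fin (k + 1) => S j) x y) =
      w 𝓐 δ k x := by
  have h1 := sub_pos.2 hδ.2
  have hs : (0 : ℝ) < Fintype.card (S k) := by exact_mod_cast hS
  have hc : ((univ.filter fun y : S k =>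
      memB 𝓐 (k + 1) (Fin.snoc (α := fun j : Fin (k + 1) => S j) x y)).card : ℝ) =
      alpha 𝓐 k x * Fintype.card (S k) := by
    unfold alpha
    field_simp
  have hc' : ((univ.filter fun y : S k =>
      ¬ memB 𝓐 (k + 1) (Fin.snoc (α := fun j : Fin (k + 1) => S j) x y)).card : ℝ) =
      (1 - alpha 𝓐 k x) * Fintype.card (S k) := by
    have h := Finset.card_filter_add_card_filter_not (s := (univ : Finset (S k)))
      (fun y : S k => memB 𝓐 (k + 1) (Fin.snoc (α := fun j : Fin (k + 1) => S j) x y))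
    rw [Finset.card_univ] at h
    have h' := congrArg (Nat.cast (R := ℝ)) h
    push_cast at h'
    linarith
  simp only [w_snoc]
  rw [Finset.sum_ite, Finset.sum_const, Finset.sum_const, nsmul_eq_mul, nsmul_eq_mul, hc, hc']
  split_ifs with ha
  · have h2 : 0 < 1 - alpha 𝓐 k x := by linarith
    rw [mul_zero, zero_add]
    field_simp
  · have h2 : 0 < alpha 𝓐 k x := hδ.1.trans_lt (not_le.1 ha)
    field_simp
    ring

theorem wH_le_prod {S : ℕ → Type} [∀ j, Fintype (S j)] {n : ℕ} {ι : Type}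
    (𝓐 : ι → Hyp S n) (δ : ℕ → ℝ) (k : ℕ) (hδ : ∀ j < k, δ j ∈ Set.Ico (0 : ℝ) 1)
    (hS : ∀ j < k, 0 < Fintype.card (S j)) (A : Hyp S n) :
    wH 𝓐 δ k A ≤
      ∏ j ∈ A.F.filter (· < k), 1 / ((1 - δ j) * (Fintype.card (S j))) := by
  induction k with
  | zero => simp [wH, w, memH]
  | succ k ih =>
    have hδk := hδ k (by omega)
    have ih := ih (fun j hj => hδ j (by omega)) (fun j hj => hS j (by omega))
    have hw : ∀ x : Qp S k, 0 ≤ w 𝓐 δ k x :=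
      w_nonneg 𝓐 δ k (fun j hj => hδ j (by omega))
    have h1 := sub_pos.2 hδk.2
    unfold wH at ih ⊢
    rw [Finset.sum_filter] at ih ⊢
    rw [sum_Qp_succ]
    simp only [memH_snoc]
    by_cases hk : k ∈ A.F
    · have hF : A.F.filter (· < k + 1) = insert k (A.F.filter (· < k)) := by
        ext j
        simp only [Finset.mem_filter, Finset.mem_insert]
        constructor
        · rintro ⟨h, h'⟩
          by_cases hj : j = k
          · exact Or.inl hj
          · exact Or.inr ⟨h, by omega⟩
        · rintro (rfl | ⟨h, h'⟩)
          · exact ⟨hk, by omega⟩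
          · exact ⟨h, by omega⟩
      rw [hF, Finset.prod_insert (by simp)]
      refine le_trans ?_ (mul_le_mul_of_nonneg_left ih (by positivity))
      rw [Finset.mul_sum]
      refine Finset.sum_le_sum fun x _ => ?_
      by_cases hx : memH A x
      · simpa [hx, hk] using w_snoc_le 𝓐 δ hδk x (hw x) (A.val k hk)
      · simp [hx]
    · have hF : A.F.filter (· < k + 1) = A.F.filter (· < k) := by
        refine Finset.filter_congr fun j hj => ?_
        have : j ≠ k := fun h => hk (h ▸ hj)
        omega
      rw [hF]
      refine le_trans (Finset.sum_le_sum fun x _ => ?_) ih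
      by_cases hx : memH A x
      · simpa [hx, hk] using (sum_w_snoc 𝓐 δ hδk (hS k (by omega)) x).le
      · simp [hx]

/-- The union bound for the weight of `B_k`. -/
theorem wB_le_sum_wH {S : ℕ → Type} [∀ j, Fintype (S j)] {n : ℕ} {ι : Type} [Fintype ι]
    (𝓐 : ι → Hyp S n) (δ : ℕ → ℝ) (k : ℕ) (hw : ∀ x : Qp S k, 0 ≤ w 𝓐 δ k x) :
    wB 𝓐 δ k ≤ ∑ i ∈ Finset.univ.filter (fun i => (𝓐 i).stage = k), wH 𝓐 δ k (𝓐 i) := by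
  unfold wB wH
  simp_rw [Finset.sum_filter (p := fun x => memH _ x)]
  rw [Finset.sum_comm, Finset.sum_filter]
  have h0 : ∀ (x : Qp S k) (i : ι), 0 ≤ if memH (𝓐 i) x then w 𝓐 δ k x else 0 := by
    intro x i
    split_ifs
    exacts [hw x, le_rfl]
  refine Finset.sum_le_sum fun x _ => ?_
  split_ifs with hx
  · obtain ⟨i, hi, hix⟩ := hx
    refine le_trans (by simp [hix]) (Finset.single_le_sum (fun i _ => h0 x i)
      (Finset.mem_filter.2 ⟨Finset.mem_univ i, hi⟩))
  · exact Finset.sum_nonneg fun i _ => h0 x i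

/-- **Lemma 3.**  If the hyperplanes of `𝒜` are pairwise non-parallel, then
for `1 ≤ k ≤ n` (the paper's `k` is `k + 1` here, `k < n`):
`w_k(B_k) ≤ ∑_{A ∈ 𝒜_k} w_k(A) ≤ ∑_{A ∈ 𝒜_k} ν(F(A))
  = ∑_{A ∈ 𝒜_k} ∏_{j ∈ F(A)} 1 / ((1 - δ_j)|S_j|)`. -/
theorem wB_le_sum_wH_le_sum_nu
    (S : ℕ → Type) [∀ j, Fintype (S j)] (n : ℕ) (hn : 0 < n)
    (hcard : ∀ j, j < n → 2 ≤ Fintype.card (S j))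
    (δ : ℕ → ℝ) (hδ : ∀ j, j < n → δ j ∈ Set.Icc (0 : ℝ) (1 / 2))
    (ι : Type) [Fintype ι] (𝓐 : ι → Hyp S n)
    (hFne : ∀ i, (𝓐 i).F.Nonempty)
    (hpar : ∀ i i', (𝓐 i).F = (𝓐 i').F → i = i')
    (k : ℕ) (hk : k < n) :
    wB 𝓐 δ (k + 1) ≤
        ∑ i ∈ Finset.univ.filter (fun i => (𝓐 i).stage = k + 1), wH 𝓐 δ (k + 1) (𝓐 i) ∧
      ∑ i ∈ Finset.univ.filter (fun i => (𝓐 i).stage = k + 1), wH 𝓐 δ (k + 1) (𝓐 i) ≤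
        ∑ i ∈ Finset.univ.filter (fun i => (𝓐 i).stage = k + 1),
          ∏ j ∈ (𝓐 i).F, 1 / ((1 - δ j) * (Fintype.card (S j))) := by
  have hδ' : ∀ j < k + 1, δ j ∈ Set.Ico (0 : ℝ) 1 := fun j hj =>
    ⟨(hδ j (by omega)).1, (hδ j (by omega)).2.trans_lt (by norm_num)⟩
  refine ⟨wB_le_sum_wH 𝓐 δ (k + 1) (w_nonneg 𝓐 δ (k + 1) hδ'),
    Finset.sum_le_sum fun i hi => ?_⟩
  have hF : (𝓐 i).F.filter (· < k + 1) = (𝓐 i).F := by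
    refine Finset.filter_true_of_mem fun j hj => ?_
    have h : j ≤ (𝓐 i).F.sup id := Finset.le_sup (f := id) hj
    have hs : (𝓐 i).F.sup id + 1 = k + 1 := (Finset.mem_filter.1 hi).2
    omega
  have h := wH_le_prod 𝓐 δ (k + 1) hδ'
    (fun j hj => lt_of_lt_of_le two_pos (hcard j (by omega))) (𝓐 i)
  rwa [hF] at h
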